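/- Let (X,f) be a dynamical system and g ∈ D_m(I) with g⁻¹(1) = {1}, i.e., g(t) = 1 only for t = 1. Then for every n ∈ ℕ and every A ∈ F(X), [(f̃_g)ⁿ(A)]_1 = fⁿ([A]_1). -/

import Mathlib

noncomputable section

open Set Metric

/-- The unit interval `I = [0,1]` as a subset of `ℝ`. -/
def I01 : Set ℝ := Set.Icc 0 1

/-- `g ∈ D_m(I)`: `g : I → I` is nondecreasing, right-continuous, `g 0 = 0`, `g 1 = 1`. -/
def Dm (g : ℝ → ℝ) : Prop :=
  MonotoneOn g I01 ∧
  (∀ x ∈ I01, ContinuousWithinAt g (I01 ∩ Set.Ici x) x) ∧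
  Set.MapsTo g I01 I01 ∧ g 0 = 0 ∧ g 1 = 1

/-- `ξ_g x = min g⁻¹([x,1])` (the min exists by right-continuity; `sInf` here). -/
def xiG (g : ℝ → ℝ) (x : ℝ) : ℝ := sInf {t | t ∈ I01 ∧ x ≤ g t}

/-- The `α`-cut `[A]_α` of a fuzzy set `A`. -/
def cut {X : Type*} (A : X → ℝ) (α : ℝ) : Set X := {x | α ≤ A x}

/-- The support of a fuzzy set. -/
def supp {X : Type*} [TopologicalSpace X] (A : X → ℝ) : Set X := closure {x | 0 < A x}

/-- The `g`-cut `[A]_α^g = {x ∈ supp A : g (A x) ≥ α}`. -/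
def gcut {X : Type*} [TopologicalSpace X] (g : ℝ → ℝ) (A : X → ℝ) (α : ℝ) : Set X :=
  {x | x ∈ supp A ∧ α ≤ g (A x)}

/-- `A ∈ F(X)`: an upper semicontinuous fuzzy set on `X`. -/
def IsFuzzy {X : Type*} [TopologicalSpace X] (A : X → ℝ) : Prop :=
  UpperSemicontinuous A ∧ ∀ x, A x ∈ I01

/-- `A ∈ F_0(X)`: a nonempty (not identically 0) upper semicontinuous fuzzy set. -/
def InF0 {X : Type*} [TopologicalSpace X] (A : X → ℝ) : Prop := IsFuzzy A ∧ ∃ x, A x ≠ 0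

/-- `A ∈ F^1(X)`: an upper semicontinuous fuzzy set attaining the value 1. -/
def InF1 {X : Type*} [TopologicalSpace X] (A : X → ℝ) : Prop := IsFuzzy A ∧ ∃ x, 1 ≤ A x

/-- The `g`-fuzzification `f̃_g(A)(x) = sup {g (A y) : y ∈ f⁻¹(x)}` (with `sup ∅ = 0`). -/
def fuzz {X : Type*} (f : X → X) (g : ℝ → ℝ) (A : X → ℝ) : X → ℝ :=
  fun x => sSup ((fun y => g (A y)) '' (f ⁻¹' {x}))

open Classical in
/-- Hausdorff metric, extended by `d_H(∅,∅) = 0` and `d_H(∅,A) = diam X`. -/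
def dH {X : Type*} [MetricSpace X] (A B : Set X) : ℝ :=
  if A = ∅ ∧ B = ∅ then 0
  else if A = ∅ ∨ B = ∅ then Metric.diam (Set.univ : Set X)
  else Metric.hausdorffDist A B

/-- The levelwise metric `d_∞(A,B) = sup {d_H([A]_α, [B]_α) : α ∈ (0,1]}`. -/
def dInfty {X : Type*} [MetricSpace X] (A B : X → ℝ) : ℝ :=
  sSup ((fun α => dH (cut A α) (cut B α)) '' Set.Ioc (0:ℝ) 1)

/-- `K(X)`: the hyperspace of nonempty compact subsets of `X`. -/
def Kc (X : Type*) [MetricSpace X] : Set (Set X) := {A | IsCompact A ∧ A.Nonempty}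

section Dyn

variable {Y : Type*}

/-- `U` is a (relatively) open subset of the space `(S, ρ)`. -/
def IsOpenIn (S : Set Y) (ρ : Y → Y → ℝ) (U : Set Y) : Prop :=
  U ⊆ S ∧ ∀ x ∈ U, ∃ ε > 0, ∀ y ∈ S, ρ x y < ε → y ∈ U

/-- Diameter of a set with respect to the distance function `ρ`. -/
def diamIn (ρ : Y → Y → ℝ) (U : Set Y) : ℝ := sSup (Set.image2 ρ U U)

/-- Sensitive dependence on initial conditions of `T` on the space `(S, ρ)`. -/
def SensitiveOn (S : Set Y) (ρ : Y → Y → ℝ) (T : Y → Y) : Prop :=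
  ∃ δ > 0, ∀ x ∈ S, ∀ ε > 0, ∃ y ∈ S, ρ x y < ε ∧ ∃ n : ℕ, δ < ρ (T^[n] x) (T^[n] y)

/-- `𝓕`-sensitivity of `T` on the space `(S, ρ)`. -/
def FSensitiveOn (S : Set Y) (ρ : Y → Y → ℝ) (T : Y → Y) (F : Set (Set ℕ)) : Prop :=
  ∃ ε > 0, ∀ U : Set Y, IsOpenIn S ρ U → U.Nonempty →
    {n : ℕ | ε < diamIn ρ (T^[n] '' U)} ∈ F

/-- Multi-sensitivity of `T` on the space `(S, ρ)`. -/
def MultiSensitiveOn (S : Set Y) (ρ : Y → Y → ℝ) (T : Y → Y) : Prop :=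
  ∃ ε > 0, ∀ (k : ℕ) (U : Fin k → Set Y),
    (∀ i, IsOpenIn S ρ (U i) ∧ (U i).Nonempty) →
    ∃ n : ℕ, ∀ i, ε < diamIn ρ (T^[n] '' U i)

/-- Topological transitivity of `T` on the space `(S, ρ)`. -/
def TransitiveOn (S : Set Y) (ρ : Y → Y → ℝ) (T : Y → Y) : Prop :=
  ∀ U V : Set Y, IsOpenIn S ρ U → U.Nonempty → IsOpenIn S ρ V → V.Nonempty →
    ∃ n : ℕ, ((T^[n] '' U) ∩ V).Nonempty

/-- Weak mixing: `T × T` is transitive on `(S × S, max-metric)`. -/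
def WeaklyMixingOn (S : Set Y) (ρ : Y → Y → ℝ) (T : Y → Y) : Prop :=
  TransitiveOn (S ×ˢ S) (fun p q => max (ρ p.1 q.1) (ρ p.2 q.2)) (Prod.map T T)

end Dyn

/-- A (proper) Furstenberg family on `ℤ⁺ = ℕ`. -/
def FurstenbergFamily (F : Set (Set ℕ)) : Prop :=
  (∀ F1 F2 : Set ℕ, F1 ∈ F → F1 ⊆ F2 → F2 ∈ F) ∧ Set.univ ∈ F ∧ ∅ ∉ F

lemma Dm.upperSemicontinuous_comp {X : Type*} [TopologicalSpace X] {g : ℝ → ℝ} (hg : Dm g)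
    {A : X → ℝ} (hA : IsFuzzy A) : UpperSemicontinuous fun x => g (A x) := by
  intro x c hc
  have hev := (hg.2.1 (A x) (hA.2 x)).eventually (gt_mem_nhds hc)
  obtain ⟨δ, hδ, h⟩ := Metric.mem_nhdsWithin_iff.1 hev
  filter_upwards [hA.1 x (A x + δ) (by linarith)] with y hy
  rcases le_total (A y) (A x) with hle | hle
  · exact (hg.1 (hA.2 y) (hA.2 x) hle).trans_lt hc
  · refine h ⟨?_, hA.2 y, hle⟩
    rw [Metric.mem_ball, Real.dist_eq, abs_of_nonneg (by linarith)]
    linarith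

lemma cut_fuzz {X : Type*} [MetricSpace X] [CompactSpace X] {f : X → X} (hf : Continuous f)
    {g : ℝ → ℝ} (hg : Dm g) {A : X → ℝ} (hA : IsFuzzy A) {α : ℝ} (hα : 0 < α) :
    cut (fuzz f g A) α = f '' {y | α ≤ g (A y)} := by
  ext x
  constructor
  · intro hx
    change α ≤ sSup _ at hx
    have hne : (f ⁻¹' {x}).Nonempty := by
      by_contra h
      rw [Set.not_nonempty_iff_eq_empty] at h
      rw [h, Set.image_empty, Real.sSup_empty] at hx
      linarith
    obtain ⟨y, hy, hmax⟩ := UpperSemicontinuousOn.exists_isMaxOn hne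
      (isClosed_singleton.preimage hf).isCompact
      ((hg.upperSemicontinuous_comp hA).upperSemicontinuousOn _)
    refine ⟨y, hx.trans (csSup_le (hne.image _) ?_), hy⟩
    rintro _ ⟨z, hz, rfl⟩
    exact hmax hz
  · rintro ⟨y, hy, rfl⟩
    change α ≤ g (A y) at hy
    change α ≤ sSup _
    refine hy.trans (le_csSup ⟨1, ?_⟩ ⟨y, rfl, rfl⟩)
    rintro _ ⟨z, -, rfl⟩
    exact (hg.2.2.1 (hA.2 z)).2

lemma IsFuzzy.fuzz {X : Type*} [MetricSpace X] [CompactSpace X] {f : X → X} (hf : Continuous f)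
    {g : ℝ → ℝ} (hg : Dm g) {A : X → ℝ} (hA : IsFuzzy A) : IsFuzzy (fuzz f g A) := by
  have h0 : ∀ x, 0 ≤ _root_.fuzz f g A x := by
    intro x
    refine Real.sSup_nonneg ?_
    rintro _ ⟨z, -, rfl⟩
    exact (hg.2.2.1 (hA.2 z)).1
  refine ⟨upperSemicontinuous_iff_isClosed_preimage.2 fun c => ?_, fun x => ⟨h0 x, ?_⟩⟩
  · rcases le_or_gt c 0 with hc | hc
    · convert isClosed_univ
      exact Set.eq_univ_of_forall fun x => hc.trans (h0 x)
    · change IsClosed (cut (_root_.fuzz f g A) c)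
      rw [cut_fuzz hf hg hA hc]
      exact (((hg.upperSemicontinuous_comp hA).isClosed_preimage c).isCompact.image hf).isClosed
  · refine Real.sSup_le ?_ zero_le_one
    rintro _ ⟨z, -, rfl⟩
    exact (hg.2.2.1 (hA.2 z)).2

lemma cut_one_fuzz {X : Type*} [MetricSpace X] [CompactSpace X] {f : X → X} (hf : Continuous f)
    {g : ℝ → ℝ} (hg : Dm g) (hg1 : ∀ t ∈ I01, (g t = 1 ↔ t = 1)) {A : X → ℝ} (hA : IsFuzzy A) :
    cut (fuzz f g A) 1 = f '' cut A 1 := by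
  rw [cut_fuzz hf hg hA one_pos]
  congr 1
  ext y
  have h1 := (hg.2.2.1 (hA.2 y)).2
  have h2 := (hA.2 y).2
  exact ⟨fun h => ((hg1 _ (hA.2 y)).1 (le_antisymm h1 h)).ge,
    fun h => ((hg1 _ (hA.2 y)).2 (le_antisymm h2 h)).ge⟩

/-- If `g ∈ D_m(I)` with `g⁻¹(1) = {1}`, then
`[(f̃_g)ⁿ(A)]_1 = fⁿ([A]_1)` for every `n ∈ ℕ` and `A ∈ F(X)`. -/
theorem stmt5 {X : Type*} [MetricSpace X] [CompactSpace X]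
    (f : X → X) (hf : Continuous f) (g : ℝ → ℝ) (hg : Dm g)
    (hg1 : ∀ t ∈ I01, (g t = 1 ↔ t = 1))
    (n : ℕ) (hn : 1 ≤ n) (A : X → ℝ) (hA : IsFuzzy A) :
    cut ((fuzz f g)^[n] A) 1 = f^[n] '' cut A 1 := by
  clear hn
  induction n generalizing A with
  | zero => simp
  | succ n ih =>
    rw [Function.iterate_succ_apply, ih _ (hA.fuzz hf hg), cut_one_fuzz hf hg hg1 hA,
      Set.image_image]
    rfl
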